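/- arXiv:1706.06172 — 3 statements merged into one kernel-verified Lean document; each statement's English description precedes it below -/
import Mathlib

section
/- Let d ∈ ℕ and let V : ℝ^d → [0,∞) be Borel measurable. For 0 ≤ s < t and x, y ∈ ℝ^d define p₀(s,x,t,y) = g(t-s,x,y) and, recursively for n ∈ ℕ, pₙ(s,x,t,y) = ∫_s^t ∫_{ℝ^d} p_{n-1}(s,x,u,z) V(z) p₀(u,z,t,y) dz du. If there exist h > 0 and 0 ≤ η < 1 such that S(V,t,x,y) ≤ η for all 0 < t ≤ h and all x, y ∈ ℝ^d, then Σ_{n=0}^∞ pₙ(0,x,t,y) ≤ (1/(1-η))^{1 + t/h} g(t,x,y) for all t > 0 and x, y ∈ ℝ^d. -/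
open MeasureTheory Real
open scoped ENNReal

/-- The Gauss–Weierstrass kernel on `ℝ^d`. -/
noncomputable def gk (d : ℕ) (t : ℝ) (x y : EuclideanSpace ℝ (Fin d)) : ℝ :=
  (4 * Real.pi * t) ^ (-(d : ℝ) / 2) * Real.exp (-‖y - x‖ ^ 2 / (4 * t))

/-- `S(V,t,x,y)`, the potential of `|V|` for the Gaussian bridges. -/
noncomputable def Sv (d : ℕ) (V : EuclideanSpace ℝ (Fin d) → ℝ) (t : ℝ)
    (x y : EuclideanSpace ℝ (Fin d)) : ℝ≥0∞ :=
  ∫⁻ s in Set.Ioo 0 t, ∫⁻ z,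
    ENNReal.ofReal (gk d s x z * gk d (t - s) z y / gk d t x y * |V z|)

section GaussianSemigroup

variable {d : ℕ}

lemma gk_pos {t : ℝ} (ht : 0 < t) (x y : EuclideanSpace ℝ (Fin d)) : 0 < gk d t x y := by
  unfold gk
  positivity

lemma measurable_gk :
    Measurable fun q : ℝ × EuclideanSpace ℝ (Fin d) × EuclideanSpace ℝ (Fin d) =>
      gk d q.1 q.2.1 q.2.2 := by
  unfold gk
  fun_prop

/-- Completing the square in the product of two Gaussian kernels. -/
lemma gk_mul_gk {s t : ℝ} (hs : 0 < s) (ht : 0 < t) (x z y : EuclideanSpace ℝ (Fin d)) :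
    gk d s x z * gk d t z y =
      gk d (s + t) x y * ((π / ((s + t) / (4 * s * t))) ^ (-(d : ℝ) / 2) *
        Real.exp (-((s + t) / (4 * s * t)) *
          ‖z - (x + (s / (s + t)) • (y - x))‖ ^ 2)) := by
  have hexp : -‖z - x‖ ^ 2 / (4 * s) + -‖y - z‖ ^ 2 / (4 * t) =
      -‖y - x‖ ^ 2 / (4 * (s + t)) + -((s + t) / (4 * s * t)) *
          ‖z - (x + (s / (s + t)) • (y - x))‖ ^ 2 := by
    have h1 : y - z = (y - x) - (z - x) := by abel
    have h2 : z - (x + (s / (s + t)) • (y - x)) = (z - x) - (s / (s + t)) • (y - x) := by abel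
    rw [h1, h2, norm_sub_sq_real (y - x), norm_sub_sq_real (z - x), inner_smul_right, norm_smul,
      real_inner_comm, mul_pow, Real.norm_eq_abs, sq_abs]
    have : s + t ≠ 0 := by positivity
    field_simp
    ring
  have hconst : (4 * π * s) ^ (-(d : ℝ) / 2) * (4 * π * t) ^ (-(d : ℝ) / 2) =
      (4 * π * (s + t)) ^ (-(d : ℝ) / 2) * (π / ((s + t) / (4 * s * t))) ^ (-(d : ℝ) / 2) := by
    rw [← Real.mul_rpow (by positivity) (by positivity),
      ← Real.mul_rpow (by positivity) (by positivity)]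
    congr 1
    have : s + t ≠ 0 := by positivity
    field_simp
  unfold gk
  rw [mul_mul_mul_comm, ← Real.exp_add, hexp, hconst, Real.exp_add]
  ring

lemma lintegral_exp_neg_mul_sq_norm {b : ℝ} (hb : 0 < b) (m : EuclideanSpace ℝ (Fin d)) :
    ∫⁻ z, ENNReal.ofReal (Real.exp (-b * ‖z - m‖ ^ 2)) =
      ENNReal.ofReal ((π / b) ^ ((d : ℝ) / 2)) := by
  have hint := GaussianFourier.integral_rexp_neg_mul_sq_norm
    (V := EuclideanSpace ℝ (Fin d)) hb
  rw [finrank_euclideanSpace_fin] at hint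
  have hpos : 0 < (π / b) ^ ((d : ℝ) / 2) := by positivity
  rw [lintegral_sub_right_eq_self (fun z => ENNReal.ofReal (Real.exp (-b * ‖z‖ ^ 2))) m,
    ← ofReal_integral_eq_lintegral_ofReal _ (ae_of_all _ fun _ => (Real.exp_pos _).le), hint]
  by_contra hni
  rw [integral_undef hni] at hint
  exact hpos.ne hint

/-- The Gaussian kernel as an extended nonnegative function, extended by zero to `t ≤ 0`. -/
noncomputable def gkE (d : ℕ) (t : ℝ) (x y : EuclideanSpace ℝ (Fin d)) : ℝ≥0∞ :=
  if 0 < t then ENNReal.ofReal (gk d t x y) else 0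

lemma gkE_of_pos {t : ℝ} (ht : 0 < t) (x y : EuclideanSpace ℝ (Fin d)) :
    gkE d t x y = ENNReal.ofReal (gk d t x y) := if_pos ht

lemma gkE_of_nonpos {t : ℝ} (ht : t ≤ 0) (x y : EuclideanSpace ℝ (Fin d)) :
    gkE d t x y = 0 := if_neg ht.not_gt

lemma measurable_gkE :
    Measurable fun q : ℝ × EuclideanSpace ℝ (Fin d) × EuclideanSpace ℝ (Fin d) =>
      gkE d q.1 q.2.1 q.2.2 :=
  Measurable.ite (measurableSet_lt measurable_const measurable_fst)
    measurable_gk.ennreal_ofReal measurable_const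

lemma Measurable.gkE {α : Type*} [MeasurableSpace α] {t : α → ℝ}
    {x y : α → EuclideanSpace ℝ (Fin d)} (ht : Measurable t) (hx : Measurable x)
    (hy : Measurable y) : Measurable fun a => gkE d (t a) (x a) (y a) :=
  measurable_gkE.comp (ht.prodMk (hx.prodMk hy))

lemma measurable_gkE_mul_gkE (s t : ℝ) (x y : EuclideanSpace ℝ (Fin d)) :
    Measurable fun z => gkE d s x z * gkE d t z y :=
  .mul (.gkE measurable_const measurable_const measurable_id)
    (.gkE measurable_const measurable_id measurable_const)

/-- The Chapman–Kolmogorov equation for the Gaussian kernel. -/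
lemma lintegral_gkE_mul_gkE {s t : ℝ} (hs : 0 < s) (ht : 0 < t)
    (x y : EuclideanSpace ℝ (Fin d)) :
    ∫⁻ z, gkE d s x z * gkE d t z y = gkE d (s + t) x y := by
  have hb : 0 < (s + t) / (4 * s * t) := by positivity
  have hc : 0 < π / ((s + t) / (4 * s * t)) := by positivity
  have hg := (gk_pos (add_pos hs ht) x y).le
  simp_rw [gkE_of_pos hs, gkE_of_pos ht, gkE_of_pos (add_pos hs ht),
    ← ENNReal.ofReal_mul (gk_pos hs _ _).le, gk_mul_gk hs ht, ENNReal.ofReal_mul hg,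
    ENNReal.ofReal_mul (Real.rpow_nonneg hc.le _)]
  rw [lintegral_const_mul _ (by fun_prop), lintegral_const_mul _ (by fun_prop),
    lintegral_exp_neg_mul_sq_norm hb, ← ENNReal.ofReal_mul (by positivity),
    ← Real.rpow_add hc, neg_div, neg_add_cancel, Real.rpow_zero, ENNReal.ofReal_one, mul_one]

end GaussianSemigroup

section Duhamel

variable {d : ℕ} {v : EuclideanSpace ℝ (Fin d) → ℝ≥0∞}

lemma gkE_ne_top (t : ℝ) (x y : EuclideanSpace ℝ (Fin d)) : gkE d t x y ≠ ∞ := by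
  unfold gkE
  split_ifs <;> simp

/-- The Duhamel operator `(t, y) ↦ ∫₀ᵗ ∫ F(u, w) v(w) g(t - u, w, y) dw du`. -/
noncomputable def duhamel (v : EuclideanSpace ℝ (Fin d) → ℝ≥0∞)
    (F : ℝ → EuclideanSpace ℝ (Fin d) → ℝ≥0∞) (t : ℝ) (y : EuclideanSpace ℝ (Fin d)) : ℝ≥0∞ :=
  ∫⁻ u in Set.Ioi 0, ∫⁻ w, F u w * v w * gkE d (t - u) w y

lemma duhamel_eq_setLIntegral_Ioo (F : ℝ → EuclideanSpace ℝ (Fin d) → ℝ≥0∞) (t : ℝ)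
    (y : EuclideanSpace ℝ (Fin d)) :
    duhamel v F t y = ∫⁻ u in Set.Ioo 0 t, ∫⁻ w, F u w * v w * gkE d (t - u) w y := by
  have hsupp : (fun u => ∫⁻ w, F u w * v w * gkE d (t - u) w y).support ⊆ Set.Iio t := by
    intro u hu
    by_contra hut
    refine hu ?_
    have : t - u ≤ 0 := sub_nonpos.2 (not_lt.1 hut)
    simp [gkE_of_nonpos this]
  rw [duhamel, ← setLIntegral_eq_of_support_subset hsupp,
    Measure.restrict_restrict measurableSet_Iio, Set.inter_comm, Set.Ioi_inter_Iio]

lemma duhamel_mono {F G : ℝ → EuclideanSpace ℝ (Fin d) → ℝ≥0∞} {t : ℝ}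
    (hFG : ∀ u, 0 < u → u < t → ∀ w, F u w ≤ G u w) (y : EuclideanSpace ℝ (Fin d)) :
    duhamel v F t y ≤ duhamel v G t y := by
  rw [duhamel_eq_setLIntegral_Ioo, duhamel_eq_setLIntegral_Ioo]
  refine setLIntegral_mono' measurableSet_Ioo fun u hu => lintegral_mono fun w => ?_
  gcongr
  exact hFG u hu.1 hu.2 w

lemma duhamel_const_mul {c : ℝ≥0∞} (hc : c ≠ ∞) (F : ℝ → EuclideanSpace ℝ (Fin d) → ℝ≥0∞)
    (t : ℝ) (y : EuclideanSpace ℝ (Fin d)) :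
    duhamel v (fun u w => c * F u w) t y = c * duhamel v F t y := by
  simp_rw [duhamel, mul_assoc, lintegral_const_mul' _ _ hc]

lemma measurable_duhamel {F : ℝ → EuclideanSpace ℝ (Fin d) → ℝ≥0∞} (hv : Measurable v)
    (hF : Measurable (Function.uncurry F)) : Measurable (Function.uncurry (duhamel v F)) := by
  refine Measurable.lintegral_prod_right' (ν := volume.restrict (Set.Ioi 0))
    (f := fun q : (ℝ × EuclideanSpace ℝ (Fin d)) × ℝ =>
      ∫⁻ w, F q.2 w * v w * gkE d (q.1.1 - q.2) w q.1.2) ?_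
  refine Measurable.lintegral_prod_right'
    (f := fun q : ((ℝ × EuclideanSpace ℝ (Fin d)) × ℝ) × EuclideanSpace ℝ (Fin d) =>
      F q.1.2 q.2 * v q.2 * gkE d (q.1.1.1 - q.1.2) q.2 q.1.1.2) ?_
  refine Measurable.mul (Measurable.mul ?_ (by fun_prop)) (.gkE ?_ ?_ ?_) <;> try fun_prop

lemma setLIntegral_Ioi_eq_add_shift (f : ℝ → ℝ≥0∞) {s : ℝ} (hs : 0 ≤ s) :
    ∫⁻ u in Set.Ioi 0, f u = (∫⁻ u in Set.Ioo 0 s, f u) + ∫⁻ r in Set.Ioi 0, f (s + r) := by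
  have hshift := (measurePreserving_add_left (volume : Measure ℝ) s).setLIntegral_comp_preimage_emb
    (MeasurableEquiv.addLeft s).measurableEmbedding f (Set.Ioi s)
  have hpre : (fun r => s + r) ⁻¹' Set.Ioi s = Set.Ioi 0 := by ext; simp
  rw [hpre] at hshift
  rw [hshift, ← Set.Ioc_union_Ioi_eq_Ioi hs,
    lintegral_union measurableSet_Ioi (Set.Ioc_disjoint_Ioi le_rfl),
    restrict_Ioo_eq_restrict_Ioc]

/-- Splitting the Duhamel integral over `(0, s + t)` at time `s`. -/
lemma duhamel_add {F : ℝ → EuclideanSpace ℝ (Fin d) → ℝ≥0∞} (hv : Measurable v)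
    (hF : Measurable (Function.uncurry F)) {s t : ℝ} (hs : 0 < s) (ht : 0 < t)
    (y : EuclideanSpace ℝ (Fin d)) :
    duhamel v F (s + t) y =
      (∫⁻ z, duhamel v F s z * gkE d t z y) + duhamel v (fun r => F (s + r)) t y := by
  rw [duhamel, setLIntegral_Ioi_eq_add_shift _ hs.le]
  congr 1
  · have hmeas : Measurable fun q : (EuclideanSpace ℝ (Fin d) × ℝ) × EuclideanSpace ℝ (Fin d) =>
        F q.1.2 q.2 * v q.2 * gkE d (s - q.1.2) q.2 q.1.1 * gkE d t q.1.1 y := by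
      refine Measurable.mul (Measurable.mul (Measurable.mul ?_ (by fun_prop)) (.gkE ?_ ?_ ?_))
        (.gkE ?_ ?_ ?_) <;> try fun_prop
    simp_rw [duhamel_eq_setLIntegral_Ioo, ← lintegral_mul_const' _ _ (gkE_ne_top t _ y)]
    refine Eq.trans ?_ (lintegral_lintegral_swap hmeas.lintegral_prod_right'.aemeasurable).symm
    refine setLIntegral_congr_fun measurableSet_Ioo fun u hu => ?_
    have hmeas' : Measurable fun q : EuclideanSpace ℝ (Fin d) × EuclideanSpace ℝ (Fin d) =>
        F u q.2 * v q.2 * gkE d (s - u) q.2 q.1 * gkE d t q.1 y :=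
      hmeas.comp (f := fun q : EuclideanSpace ℝ (Fin d) × EuclideanSpace ℝ (Fin d) =>
        ((q.1, u), q.2)) (by fun_prop)
    rw [lintegral_lintegral_swap hmeas'.aemeasurable]
    refine lintegral_congr fun w => ?_
    simp_rw [mul_assoc (F u w * v w)]
    rw [lintegral_const_mul _ (measurable_gkE_mul_gkE _ _ _ _),
      lintegral_gkE_mul_gkE (sub_pos.2 hu.2) ht, sub_add_eq_add_sub]
  · simp_rw [duhamel, add_sub_add_left_eq_sub]

/-- A bound on the Duhamel integral of the Gaussian kernel persists under time shifts. -/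
lemma duhamel_gkE_shift_le (hv : Measurable v) {η : ℝ≥0∞} (hη : η ≠ ∞) {t : ℝ} (ht : 0 < t)
    {y : EuclideanSpace ℝ (Fin d)}
    (hS : ∀ z, duhamel v (fun u w => gkE d u z w) t y ≤ η * gkE d t z y)
    {s : ℝ} (hs : 0 < s) (x : EuclideanSpace ℝ (Fin d)) :
    duhamel v (fun u w => gkE d (s + u) x w) t y ≤ η * gkE d (s + t) x y := by
  have hmeas : Measurable fun q : (EuclideanSpace ℝ (Fin d) × ℝ) × EuclideanSpace ℝ (Fin d) =>
      gkE d s x q.1.1 * (gkE d q.1.2 q.1.1 q.2 * v q.2 * gkE d (t - q.1.2) q.2 y) := by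
    refine Measurable.mul (.gkE ?_ ?_ ?_) (.mul (.mul (.gkE ?_ ?_ ?_) ?_) (.gkE ?_ ?_ ?_)) <;>
      fun_prop
  calc duhamel v (fun u w => gkE d (s + u) x w) t y
      = ∫⁻ z, gkE d s x z * duhamel v (fun u w => gkE d u z w) t y := by
        simp_rw [duhamel, ← lintegral_const_mul' _ _ (gkE_ne_top s x _)]
        refine Eq.trans ?_ (lintegral_lintegral_swap hmeas.lintegral_prod_right'.aemeasurable).symm
        refine setLIntegral_congr_fun measurableSet_Ioi fun u hu => ?_
        have hmeas' : Measurable fun q : EuclideanSpace ℝ (Fin d) × EuclideanSpace ℝ (Fin d) =>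
            gkE d s x q.1 * (gkE d u q.1 q.2 * v q.2 * gkE d (t - u) q.2 y) :=
          hmeas.comp (f := fun q : EuclideanSpace ℝ (Fin d) × EuclideanSpace ℝ (Fin d) =>
            ((q.1, u), q.2)) (by fun_prop)
        rw [lintegral_lintegral_swap hmeas'.aemeasurable]
        refine lintegral_congr fun w => ?_
        simp_rw [mul_assoc (gkE d u _ w), ← mul_assoc (gkE d s x _)]
        rw [lintegral_mul_const _ (measurable_gkE_mul_gkE _ _ _ _), lintegral_gkE_mul_gkE hs hu,
          mul_assoc]
    _ ≤ ∫⁻ z, η * (gkE d s x z * gkE d t z y) := by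
        refine lintegral_mono fun z => ?_
        rw [mul_left_comm]
        gcongr
        exact hS z
    _ = η * gkE d (s + t) x y := by
        rw [lintegral_const_mul' _ _ hη, lintegral_gkE_mul_gkE hs ht]

end Duhamel

section PerturbationSeries

variable {d : ℕ} {v : EuclideanSpace ℝ (Fin d) → ℝ≥0∞}

/-- The partial sums of the perturbation series of the Gaussian kernel by `v`. -/
noncomputable def perturbSum (v : EuclideanSpace ℝ (Fin d) → ℝ≥0∞)
    (x : EuclideanSpace ℝ (Fin d)) : ℕ → ℝ → EuclideanSpace ℝ (Fin d) → ℝ≥0∞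
  | 0, t, y => gkE d t x y
  | N + 1, t, y => gkE d t x y + duhamel v (perturbSum v x N) t y

lemma measurable_perturbSum (hv : Measurable v) (x : EuclideanSpace ℝ (Fin d)) (N : ℕ) :
    Measurable (Function.uncurry (perturbSum v x N)) := by
  have hg : Measurable fun q : ℝ × EuclideanSpace ℝ (Fin d) => gkE d q.1 x q.2 :=
    .gkE measurable_fst measurable_const measurable_snd
  induction N with
  | zero => exact hg
  | succ N ih => exact hg.add (measurable_duhamel hv ih)

variable {C η : ℝ≥0∞} {h : ℝ}

lemma perturbSum_le_of_le (hC : C ≠ ∞) (hCη : 1 + C * η = C)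
    (hS : ∀ t x y, 0 < t → t ≤ h → duhamel v (fun u w => gkE d u x w) t y ≤ η * gkE d t x y)
    (x : EuclideanSpace ℝ (Fin d)) (N : ℕ) {t : ℝ} (ht : 0 < t) (hth : t ≤ h)
    (y : EuclideanSpace ℝ (Fin d)) :
    perturbSum v x N t y ≤ C * gkE d t x y := by
  induction N generalizing t y with
  | zero => exact le_mul_of_one_le_left' (hCη ▸ le_self_add)
  | succ N ih =>
    calc gkE d t x y + duhamel v (perturbSum v x N) t y
        ≤ gkE d t x y + C * duhamel v (fun u w => gkE d u x w) t y := by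
          rw [← duhamel_const_mul hC]
          gcongr
          exact duhamel_mono (fun u hu hut w => ih hu (hut.le.trans hth) w) y
      _ ≤ gkE d t x y + C * (η * gkE d t x y) := by
          gcongr
          exact hS t x y ht hth
      _ = (1 + C * η) * gkE d t x y := by ring
      _ = C * gkE d t x y := by rw [hCη]

/-- A bound for the partial sums at time `s` yields a bound on `(s, s + h]`. -/
lemma perturbSum_add_le (hv : Measurable v) (hC : C ≠ ∞) (hCη : 1 + C * η = C) (hη : η ≠ ∞)
    (hS : ∀ t x y, 0 < t → t ≤ h → duhamel v (fun u w => gkE d u x w) t y ≤ η * gkE d t x y)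
    {A : ℝ≥0∞} (hA : A ≠ ∞) (hA1 : 1 ≤ A) {s : ℝ} (hs : 0 < s) {x : EuclideanSpace ℝ (Fin d)}
    (hbound : ∀ N y, perturbSum v x N s y ≤ A * gkE d s x y)
    (N : ℕ) {t : ℝ} (ht : 0 < t) (hth : t ≤ h) (y : EuclideanSpace ℝ (Fin d)) :
    perturbSum v x N (s + t) y ≤ A * C * gkE d (s + t) x y := by
  induction N generalizing t y with
  | zero => exact le_mul_of_one_le_left' (one_le_mul hA1 (hCη ▸ le_self_add))
  | succ N ih =>
    calc gkE d (s + t) x y + duhamel v (perturbSum v x N) (s + t) y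
        = (∫⁻ z, perturbSum v x (N + 1) s z * gkE d t z y) +
            duhamel v (fun r => perturbSum v x N (s + r)) t y := by
          rw [duhamel_add hv (measurable_perturbSum hv x N) hs ht, ← add_assoc]
          simp_rw [perturbSum, add_mul]
          rw [lintegral_add_left (measurable_gkE_mul_gkE _ _ _ _), lintegral_gkE_mul_gkE hs ht]
      _ ≤ (∫⁻ z, A * (gkE d s x z * gkE d t z y)) +
            duhamel v (fun r w => A * C * gkE d (s + r) x w) t y := by
          refine add_le_add (lintegral_mono fun z => ?_) ?_
          · rw [← mul_assoc]
            gcongr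
            exact hbound _ _
          · exact duhamel_mono (fun u hu hut w => ih hu (hut.le.trans hth) w) y
      _ ≤ A * gkE d (s + t) x y + A * C * (η * gkE d (s + t) x y) := by
          rw [lintegral_const_mul' _ _ hA, lintegral_gkE_mul_gkE hs ht,
            duhamel_const_mul (ENNReal.mul_ne_top hA hC)]
          gcongr
          exact duhamel_gkE_shift_le hv hη ht (fun z => hS t z y ht hth) hs x
      _ = A * (1 + C * η) * gkE d (s + t) x y := by ring
      _ = A * C * gkE d (s + t) x y := by rw [hCη]

lemma perturbSum_le_pow (hv : Measurable v) (hC : C ≠ ∞) (hCη : 1 + C * η = C) (hη : η ≠ ∞)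
    (hS : ∀ t x y, 0 < t → t ≤ h → duhamel v (fun u w => gkE d u x w) t y ≤ η * gkE d t x y)
    (x : EuclideanSpace ℝ (Fin d)) (k N : ℕ) {t : ℝ} (ht : 0 < t) (hth : t ≤ (k + 1) * h)
    (y : EuclideanSpace ℝ (Fin d)) :
    perturbSum v x N t y ≤ C ^ (k + 1) * gkE d t x y := by
  induction k generalizing N t y with
  | zero =>
    rw [zero_add, pow_one]
    exact perturbSum_le_of_le hC hCη hS x N ht (by simpa using hth) y
  | succ k ih =>
    push_cast at hth
    have hk : (0 : ℝ) < k + 1 + 1 := by positivity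
    have hr : t / (k + 1 + 1) ≤ h := (div_le_iff₀' hk).2 hth
    have hr0 : 0 < t / (k + 1 + 1) := by positivity
    have hsplit : t = (k + 1) * (t / (k + 1 + 1)) + t / (k + 1 + 1) := by field_simp
    have hs : 0 < (k + 1 : ℝ) * (t / (k + 1 + 1)) := by positivity
    rw [hsplit, pow_succ]
    exact perturbSum_add_le hv hC hCη hη hS (ENNReal.pow_ne_top hC)
      (one_le_pow₀ (hCη ▸ le_self_add)) hs (fun N y => ih N hs (by gcongr) y) N hr0 hr y

/-- Superadditivity of the lower integral over finite sums, without measurability. -/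
lemma sum_lintegral_le_lintegral_sum {α ι : Type*} [MeasurableSpace α] (μ : Measure α)
    (s : Finset ι) (f : ι → α → ℝ≥0∞) :
    ∑ i ∈ s, ∫⁻ a, f i a ∂μ ≤ ∫⁻ a, ∑ i ∈ s, f i a ∂μ := by
  classical
  induction s using Finset.induction_on with
  | empty => simp
  | insert i s hi ih =>
    simp_rw [Finset.sum_insert hi]
    exact (add_le_add_right ih _).trans (le_lintegral_add _ _)

/-- The potential `Sv` expresses the Duhamel integral of the Gaussian kernel. -/
lemma duhamel_gkE_eq_Sv_mul (V : EuclideanSpace ℝ (Fin d) → ℝ) {t : ℝ} (ht : 0 < t)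
    (x y : EuclideanSpace ℝ (Fin d)) :
    duhamel (fun z => ENNReal.ofReal |V z|) (fun u w => gkE d u x w) t y =
      Sv d V t x y * gkE d t x y := by
  simp_rw [duhamel_eq_setLIntegral_Ioo, Sv, ← lintegral_mul_const' _ _ (gkE_ne_top t x y)]
  refine setLIntegral_congr_fun measurableSet_Ioo fun u hu => lintegral_congr fun w => ?_
  have h1 := gk_pos hu.1 x w
  have h2 := gk_pos (sub_pos.2 hu.2) w y
  have h3 := gk_pos ht x y
  rw [gkE_of_pos hu.1, gkE_of_pos (sub_pos.2 hu.2), gkE_of_pos ht, ← ENNReal.ofReal_mul h1.le,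
    ← ENNReal.ofReal_mul (by positivity), ← ENNReal.ofReal_mul (by positivity)]
  congr 1
  field_simp

lemma sum_enorm_le_perturbSum {V : EuclideanSpace ℝ (Fin d) → ℝ}
    {p : ℕ → ℝ → EuclideanSpace ℝ (Fin d) → ℝ → EuclideanSpace ℝ (Fin d) → ℝ}
    (hp0 : ∀ s x t y, p 0 s x t y = gk d (t - s) x y)
    (hprec : ∀ n : ℕ, ∀ s t : ℝ, ∀ x y, 0 ≤ s → s < t →
      p (n + 1) s x t y =
        ∫ u in Set.Ioo s t, ∫ z, p n s x u z * V z * gk d (t - u) z y)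
    (x : EuclideanSpace ℝ (Fin d)) (N : ℕ) {t : ℝ} (ht : 0 < t)
    (y : EuclideanSpace ℝ (Fin d)) :
    ∑ n ∈ Finset.range (N + 1), ‖p n 0 x t y‖ₑ ≤
      perturbSum (fun z => ENNReal.ofReal |V z|) x N t y := by
  have h0 : ∀ {t : ℝ}, 0 < t → ∀ y, ‖p 0 0 x t y‖ₑ = gkE d t x y := fun {t} ht y => by
    rw [hp0, sub_zero, gkE_of_pos ht, Real.enorm_of_nonneg (gk_pos ht x y).le]
  induction N generalizing t y with
  | zero => simp [h0 ht, perturbSum]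
  | succ N ih =>
    rw [Finset.sum_range_succ', add_comm, h0 ht, perturbSum, duhamel_eq_setLIntegral_Ioo]
    gcongr
    calc ∑ n ∈ Finset.range (N + 1), ‖p (n + 1) 0 x t y‖ₑ
        ≤ ∑ n ∈ Finset.range (N + 1), ∫⁻ u in Set.Ioo 0 t, ∫⁻ z,
            ‖p n 0 x u z * V z * gk d (t - u) z y‖ₑ := by
          refine Finset.sum_le_sum fun n _ => ?_
          rw [hprec n 0 t x y le_rfl ht]
          exact (enorm_integral_le_lintegral_enorm _).trans
            (lintegral_mono fun u => enorm_integral_le_lintegral_enorm _)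
      _ ≤ ∫⁻ u in Set.Ioo 0 t, ∫⁻ z, ∑ n ∈ Finset.range (N + 1),
            ‖p n 0 x u z * V z * gk d (t - u) z y‖ₑ :=
          (sum_lintegral_le_lintegral_sum _ _ _).trans
            (lintegral_mono fun u => sum_lintegral_le_lintegral_sum _ _ _)
      _ ≤ _ := by
          refine setLIntegral_mono' measurableSet_Ioo fun u hu => lintegral_mono fun z => ?_
          simp_rw [enorm_mul, ← Finset.sum_mul]
          rw [gkE_of_pos (sub_pos.2 hu.2),
            Real.enorm_of_nonneg (gk_pos (sub_pos.2 hu.2) z y).le, Real.enorm_eq_ofReal_abs (V z)]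
          gcongr
          exact ih hu.1 z

end PerturbationSeries

theorem perturbation_series_bound
    (d : ℕ) (V : EuclideanSpace ℝ (Fin d) → ℝ) (hV : Measurable V)
    (hVnonneg : ∀ z, 0 ≤ V z)
    (p : ℕ → ℝ → EuclideanSpace ℝ (Fin d) → ℝ → EuclideanSpace ℝ (Fin d) → ℝ)
    (hp0 : ∀ s x t y, p 0 s x t y = gk d (t - s) x y)
    (hprec : ∀ n : ℕ, ∀ s t : ℝ, ∀ x y, 0 ≤ s → s < t →
      p (n + 1) s x t y =
        ∫ u in Set.Ioo s t, ∫ z, p n s x u z * V z * gk d (t - u) z y)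
    (h η : ℝ) (hh : 0 < h) (hη0 : 0 ≤ η) (hη1 : η < 1)
    (hS : ∀ t x y, 0 < t → t ≤ h → Sv d V t x y ≤ ENNReal.ofReal η) :
    ∀ t x y, 0 < t →
      (∑' n : ℕ, ENNReal.ofReal (p n 0 x t y)) ≤
        ENNReal.ofReal ((1 / (1 - η)) ^ (1 + t / h) * gk d t x y) := by
  have hη' : 0 < 1 - η := sub_pos.2 hη1
  have hC1 : 1 ≤ 1 / (1 - η) := (one_le_div hη').2 (by linarith)
  have hC0 : 0 ≤ 1 / (1 - η) := zero_le_one.trans hC1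
  have hCη : 1 + ENNReal.ofReal (1 / (1 - η)) * ENNReal.ofReal η =
      ENNReal.ofReal (1 / (1 - η)) := by
    rw [← ENNReal.ofReal_mul hC0, ← ENNReal.ofReal_one,
      ← ENNReal.ofReal_add zero_le_one (mul_nonneg hC0 hη0)]
    congr 1
    field_simp
    ring
  intro t x y ht
  have hk : t ≤ (⌊t / h⌋₊ + 1) * h := (div_le_iff₀ hh).1 (Nat.lt_floor_add_one _).le
  have hpow : (1 / (1 - η)) ^ (⌊t / h⌋₊ + 1) ≤ (1 / (1 - η)) ^ (1 + t / h) := by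
    rw [← Real.rpow_natCast]
    refine Real.rpow_le_rpow_of_exponent_le hC1 ?_
    have := Nat.floor_le (div_nonneg ht.le hh.le)
    push_cast
    linarith
  refine ENNReal.tsum_le_of_sum_range_le fun N => ?_
  calc ∑ n ∈ Finset.range N, ENNReal.ofReal (p n 0 x t y)
      ≤ ∑ n ∈ Finset.range (N + 1), ‖p n 0 x t y‖ₑ :=
        (Finset.sum_le_sum fun n _ => Real.ofReal_le_enorm _).trans
          (Finset.sum_le_sum_of_subset (Finset.range_mono N.le_succ))
    _ ≤ perturbSum (fun z => ENNReal.ofReal |V z|) x N t y :=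
        sum_enorm_le_perturbSum hp0 hprec x N ht y
    _ ≤ ENNReal.ofReal (1 / (1 - η)) ^ (⌊t / h⌋₊ + 1) * gkE d t x y := by
        refine perturbSum_le_pow (by fun_prop) ENNReal.ofReal_ne_top hCη ENNReal.ofReal_ne_top
          (fun t x y ht hth => ?_) x _ N ht hk y
        rw [duhamel_gkE_eq_Sv_mul V ht]
        gcongr
        exact hS t x y ht hth
    _ ≤ ENNReal.ofReal ((1 / (1 - η)) ^ (1 + t / h) * gk d t x y) := by
        rw [gkE_of_pos ht, ← ENNReal.ofReal_pow hC0, ← ENNReal.ofReal_mul (pow_nonneg hC0 _)]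
        exact ENNReal.ofReal_le_ofReal (mul_le_mul_of_nonneg_right hpow (gk_pos ht x y).le)
end

section
/- For every d ∈ ℕ there exist constants 0 < c₁, c₂ < ∞ depending only on d such that for every Borel measurable V : ℝ^d → ℝ, c₁ (4π)^{d/2} e_*(V,0) ≤ ‖S(V)‖_∞ ≤ c₂ (4π)^{d/2} e_*(V,0), where both sides are understood in [0,∞]. -/
open MeasureTheory Real
open scoped ENNReal

/-- `‖S(V)‖_∞`. -/
noncomputable def Ssup (d : ℕ) (V : EuclideanSpace ℝ (Fin d) → ℝ) : ℝ≥0∞ :=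
  ⨆ (t : ℝ) (_ : 0 < t) (x : EuclideanSpace ℝ (Fin d)) (y : EuclideanSpace ℝ (Fin d)),
    Sv d V t x y

/-- The kernel `J(x,y) = ∫₀^∞ τ^{-d/2} e^{-|x-τy|²/(4τ)} dτ`. -/
noncomputable def Jk (d : ℕ) (x y : EuclideanSpace ℝ (Fin d)) : ℝ≥0∞ :=
  ∫⁻ τ in Set.Ioi (0 : ℝ),
    ENNReal.ofReal (τ ^ (-(d : ℝ) / 2) * Real.exp (-‖x - τ • y‖ ^ 2 / (4 * τ)))

/-- `e_*(V,0)`. -/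
noncomputable def estar (d : ℕ) (V : EuclideanSpace ℝ (Fin d) → ℝ) : ℝ≥0∞ :=
  ENNReal.ofReal ((4 * Real.pi) ^ (-(d : ℝ) / 2)) *
    ⨆ (x : EuclideanSpace ℝ (Fin d)) (y : EuclideanSpace ℝ (Fin d)),
      ∫⁻ z, Jk d (z - x) y * ENNReal.ofReal |V z|

section

variable {d : ℕ}

lemma gk_comm (t : ℝ) (x y : EuclideanSpace ℝ (Fin d)) : gk d t x y = gk d t y x := by
  rw [gk, gk, norm_sub_rev]

lemma gk_nonneg {t : ℝ} (ht : 0 ≤ t) (x y : EuclideanSpace ℝ (Fin d)) : 0 ≤ gk d t x y := by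
  unfold gk
  positivity

/-- The Gaussian bridge density is a heat kernel centred on the segment from `x` to `y`. -/
lemma gk_bridge {s t : ℝ} (hs : 0 < s) (hst : s < t) (x y z : EuclideanSpace ℝ (Fin d)) :
    gk d s x z * gk d (t - s) z y / gk d t x y
      = gk d (s * (t - s) / t) (x + s • t⁻¹ • (y - x)) z := by
  have ht : 0 < t := hs.trans hst
  have hts : 0 < t - s := sub_pos.2 hst
  have hpi := Real.pi_pos
  obtain ⟨a, rfl⟩ : ∃ a, z = x + a := ⟨z - x, by abel⟩
  obtain ⟨b, rfl⟩ : ∃ b, y = x + b := ⟨y - x, by abel⟩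
  have e1 : (4 * π * s) * (4 * π * (t - s)) / (4 * π * t) = 4 * π * (s * (t - s) / t) := by
    field_simp
  have e2 : x + b - (x + a) = b - a := by abel
  have e3 : x + a - (x + s • t⁻¹ • (x + b - x)) = a - (s * t⁻¹) • b := by
    rw [smul_smul, add_sub_cancel_left]; abel
  unfold gk
  rw [e3, e2, ← e1, Real.div_rpow (by positivity) (by positivity),
    Real.mul_rpow (by positivity : 0 ≤ 4 * π * s) (by positivity), add_sub_cancel_left, add_sub_cancel_left,
    mul_mul_mul_comm, ← Real.exp_add, mul_div_mul_comm, ← Real.exp_sub]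
  congr 2
  rw [norm_sub_sq_real, norm_sub_sq_real, norm_smul, real_inner_smul_right, mul_pow,
    Real.norm_eq_abs, sq_abs, real_inner_comm b a]
  field_simp
  ring

lemma gk_le_of_half_le {s r : ℝ} (hs : 0 < s) (hr : s / 2 ≤ r) (hrs : r ≤ s)
    (x y : EuclideanSpace ℝ (Fin d)) : gk d r x y ≤ 2 ^ ((d : ℝ) / 2) * gk d s x y := by
  have hr0 : 0 < r := by linarith
  have hpi := Real.pi_pos
  have h : (4 * π * r) ^ (-(d : ℝ) / 2) ≤ 2 ^ ((d : ℝ) / 2) * (4 * π * s) ^ (-(d : ℝ) / 2) := by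
    calc (4 * π * r) ^ (-(d : ℝ) / 2) ≤ (2⁻¹ * (4 * π * s)) ^ (-(d : ℝ) / 2) :=
          Real.rpow_le_rpow_of_nonpos (by positivity) (by nlinarith)
            (by rw [neg_div]; exact neg_nonpos.2 (by positivity))
      _ = 2 ^ ((d : ℝ) / 2) * (4 * π * s) ^ (-(d : ℝ) / 2) := by
          rw [Real.mul_rpow (by positivity) (by positivity), Real.inv_rpow (by positivity),
            neg_div, Real.rpow_neg (by positivity : (0:ℝ) ≤ 2), inv_inv]
  unfold gk
  rw [← mul_assoc]
  refine mul_le_mul h (Real.exp_le_exp.2 ?_) (by positivity) (by positivity)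
  rw [neg_div, neg_div, neg_le_neg_iff]
  gcongr

lemma gk_bridge_le_of_le_half {s t : ℝ} (hs : 0 < s) (hst : s ≤ t / 2)
    (x y z : EuclideanSpace ℝ (Fin d)) :
    gk d s x z * gk d (t - s) z y / gk d t x y
      ≤ 2 ^ ((d : ℝ) / 2) * gk d s (x + s • t⁻¹ • (y - x)) z := by
  have ht : 0 < t := by linarith
  rw [gk_bridge hs (by linarith)]
  apply gk_le_of_half_le hs
  · rw [le_div_iff₀ ht]; nlinarith
  · rw [div_le_iff₀ ht]; nlinarith

lemma gk_bridge_le {s t : ℝ} (hs : 0 < s) (hst : s < t) (x y z : EuclideanSpace ℝ (Fin d)) :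
    gk d s x z * gk d (t - s) z y / gk d t x y
      ≤ 2 ^ ((d : ℝ) / 2) * gk d s (x + s • t⁻¹ • (y - x)) z
        + 2 ^ ((d : ℝ) / 2) * gk d (t - s) (y + (t - s) • t⁻¹ • (x - y)) z := by
  have hts : 0 < t - s := sub_pos.2 hst
  rcases le_total s (t / 2) with h | h
  · refine (gk_bridge_le_of_le_half hs h x y z).trans (le_add_of_nonneg_right ?_)
    exact mul_nonneg (by positivity) (gk_nonneg hts.le _ _)
  · have key := gk_bridge_le_of_le_half hts (by linarith : t - s ≤ t / 2) y x z
    rw [sub_sub_cancel, gk_comm (t - s) y z, gk_comm s z x, gk_comm t y x, mul_comm] at key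
    exact key.trans (le_add_of_nonneg_left
      (mul_nonneg (by positivity) (gk_nonneg hs.le _ _)))

lemma measurable_gk_s7 {α : Type*} [MeasurableSpace α] {r : α → ℝ}
    {p q : α → EuclideanSpace ℝ (Fin d)} (hr : Measurable r) (hp : Measurable p)
    (hq : Measurable q) : Measurable fun a => gk d (r a) (p a) (q a) := by
  unfold gk
  exact ((hr.const_mul _).pow_const _).mul
    (((hq.sub hp).norm.pow_const 2).neg.div (hr.const_mul _)).exp

/-- The potential of `|V|` along the Brownian motion started at `x` with constant drift `y`. -/
noncomputable def driftPotential (V : EuclideanSpace ℝ (Fin d) → ℝ)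
    (x y : EuclideanSpace ℝ (Fin d)) : ℝ≥0∞ :=
  ∫⁻ s in Set.Ioi (0 : ℝ), ∫⁻ z, ENNReal.ofReal (gk d s (x + s • y) z * |V z|)

lemma measurable_ofReal_gk_mul {α : Type*} [MeasurableSpace α]
    {V : EuclideanSpace ℝ (Fin d) → ℝ} (hV : Measurable V) {r : α → ℝ}
    {p : α → EuclideanSpace ℝ (Fin d)} (hr : Measurable r) (hp : Measurable p) :
    Measurable fun a : α × EuclideanSpace ℝ (Fin d) =>
      ENNReal.ofReal (gk d (r a.1) (p a.1) a.2 * |V a.2|) :=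
  ((measurable_gk_s7 (hr.comp measurable_fst) (hp.comp measurable_fst) measurable_snd).mul
    (_root_.continuous_abs.measurable.comp (hV.comp measurable_snd))).ennreal_ofReal

lemma estar_eq_iSup_driftPotential {V : EuclideanSpace ℝ (Fin d) → ℝ} (hV : Measurable V) :
    estar d V = ⨆ (x : EuclideanSpace ℝ (Fin d)) (y : EuclideanSpace ℝ (Fin d)),
      driftPotential V x y := by
  have hpi := Real.pi_pos
  unfold estar
  simp_rw [ENNReal.mul_iSup]
  refine iSup_congr fun x => iSup_congr fun y => ?_
  have hm : Measurable fun a : ℝ × EuclideanSpace ℝ (Fin d) =>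
      ENNReal.ofReal (gk d a.1 (x + a.1 • y) a.2 * |V a.2|) :=
    measurable_ofReal_gk_mul hV (r := fun s => s) (p := fun s => x + s • y) (by fun_prop)
      (by fun_prop)
  unfold driftPotential
  rw [lintegral_lintegral_swap hm.aemeasurable, ← lintegral_const_mul' _ _ ENNReal.ofReal_ne_top]
  refine lintegral_congr fun z => ?_
  unfold Jk
  rw [← lintegral_mul_const' _ _ ENNReal.ofReal_ne_top,
    ← lintegral_const_mul' _ _ ENNReal.ofReal_ne_top]
  refine setLIntegral_congr_fun measurableSet_Ioi fun s hs => ?_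
  have hs0 : (0 : ℝ) < s := hs
  rw [← ENNReal.ofReal_mul (by positivity), ← ENNReal.ofReal_mul (by positivity), gk,
    Real.mul_rpow (by positivity) hs0.le, sub_add_eq_sub_sub]
  ring_nf

lemma setLIntegral_Ioo_comp_sub_le (f : ℝ → ℝ≥0∞) (t : ℝ) :
    ∫⁻ s in Set.Ioo 0 t, f (t - s) ≤ ∫⁻ s in Set.Ioi (0 : ℝ), f s := by
  rw [← lintegral_indicator measurableSet_Ioo, ← lintegral_indicator measurableSet_Ioi,
    ← lintegral_sub_left_eq_self ((Set.Ioi (0 : ℝ)).indicator f) t]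
  refine lintegral_mono fun s => ?_
  by_cases h : s ∈ Set.Ioo 0 t
  · rw [Set.indicator_of_mem h, Set.indicator_of_mem (Set.mem_Ioi.2 (sub_pos.2 h.2))]
  · rw [Set.indicator_of_notMem h]
    exact zero_le

lemma Sv_le {V : EuclideanSpace ℝ (Fin d) → ℝ} (hV : Measurable V) (t : ℝ)
    (x y : EuclideanSpace ℝ (Fin d)) :
    Sv d V t x y ≤ ENNReal.ofReal (2 ^ ((d : ℝ) / 2)) *
      (driftPotential V x (t⁻¹ • (y - x)) + driftPotential V y (t⁻¹ • (x - y))) := by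
  have hm (u v : EuclideanSpace ℝ (Fin d)) : Measurable fun a : ℝ × EuclideanSpace ℝ (Fin d) =>
      ENNReal.ofReal (gk d a.1 (u + a.1 • v) a.2 * |V a.2|) :=
    measurable_ofReal_gk_mul hV (r := fun s => s) (p := fun s => u + s • v) (by fun_prop)
      (by fun_prop)
  set G : EuclideanSpace ℝ (Fin d) → EuclideanSpace ℝ (Fin d) → ℝ → ℝ≥0∞ :=
    fun u v s => ∫⁻ z, ENNReal.ofReal (gk d s (u + s • v) z * |V z|) with hG
  have hGm (u v) : Measurable (G u v) := (hm u v).lintegral_prod_right'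
  calc Sv d V t x y
      ≤ ∫⁻ s in Set.Ioo 0 t, ENNReal.ofReal (2 ^ ((d : ℝ) / 2)) *
          (G x (t⁻¹ • (y - x)) s + G y (t⁻¹ • (x - y)) (t - s)) := by
        refine setLIntegral_mono' measurableSet_Ioo fun s hs => ?_
        have hts : 0 < t - s := sub_pos.2 hs.2
        rw [hG]
        simp only
        have hmz := (hm x (t⁻¹ • (y - x))).comp (measurable_prodMk_left (x := s))
        simp only [Function.comp_def] at hmz
        rw [← lintegral_add_left hmz,
          ← lintegral_const_mul' _ _ ENNReal.ofReal_ne_top]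
        refine lintegral_mono fun z => ?_
        have h1 := gk_nonneg hs.1.le (x + s • t⁻¹ • (y - x)) z
        have h2 := gk_nonneg hts.le (y + (t - s) • t⁻¹ • (x - y)) z
        rw [← ENNReal.ofReal_add (by positivity) (by positivity),
          ← ENNReal.ofReal_mul (by positivity)]
        refine ENNReal.ofReal_le_ofReal ?_
        have := mul_le_mul_of_nonneg_right (gk_bridge_le hs.1 hs.2 x y z) (abs_nonneg (V z))
        linarith
    _ = ENNReal.ofReal (2 ^ ((d : ℝ) / 2)) * ((∫⁻ s in Set.Ioo 0 t, G x (t⁻¹ • (y - x)) s)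
          + ∫⁻ s in Set.Ioo 0 t, G y (t⁻¹ • (x - y)) (t - s)) := by
        rw [lintegral_const_mul' _ _ ENNReal.ofReal_ne_top, lintegral_add_left (hGm _ _)]
    _ ≤ _ := by
        gcongr
        · exact lintegral_mono_set Set.Ioo_subset_Ioi_self
        · exact setLIntegral_Ioo_comp_sub_le _ t

lemma continuousAt_gk_time {s : ℝ} (hs : 0 < s) (x y : EuclideanSpace ℝ (Fin d)) :
    ContinuousAt (fun r => gk d r x y) s := by
  have hpi := Real.pi_pos
  unfold gk
  refine ContinuousAt.mul (ContinuousAt.rpow_const (by fun_prop) (Or.inl (by positivity))) ?_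
  exact (ContinuousAt.div (by fun_prop) (by fun_prop) (by positivity)).rexp

lemma lintegral_gk_mul_le_liminf {V : EuclideanSpace ℝ (Fin d) → ℝ} (hV : Measurable V)
    {s : ℝ} (hs : 0 < s) {r : ℕ → ℝ} (hr : Filter.Tendsto r Filter.atTop (nhds s))
    (p : EuclideanSpace ℝ (Fin d)) :
    ∫⁻ z, ENNReal.ofReal (gk d s p z * |V z|)
      ≤ Filter.liminf (fun n => ∫⁻ z, ENNReal.ofReal (gk d (r n) p z * |V z|)) Filter.atTop := by
  have hm (n : ℕ) : Measurable fun z => ENNReal.ofReal (gk d (r n) p z * |V z|) :=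
    ((measurable_gk_s7 measurable_const measurable_const measurable_id).mul
      (_root_.continuous_abs.measurable.comp hV)).ennreal_ofReal
  refine le_trans (le_of_eq ?_) (lintegral_liminf_le hm)
  refine lintegral_congr fun z => (Filter.Tendsto.liminf_eq ?_).symm
  exact ENNReal.tendsto_ofReal
    (((continuousAt_gk_time hs p z).tendsto.comp hr).mul_const _)

lemma driftPotential_le_Ssup {V : EuclideanSpace ℝ (Fin d) → ℝ} (hV : Measurable V)
    (x y : EuclideanSpace ℝ (Fin d)) : driftPotential V x y ≤ Ssup d V := by
  let T : ℕ → ℝ := fun n => n + 1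
  have hT (n : ℕ) : 0 < T n := by positivity
  have hTtop : Filter.Tendsto T Filter.atTop Filter.atTop :=
    Filter.tendsto_atTop_add_const_right _ _ tendsto_natCast_atTop_atTop
  have hm (n : ℕ) : Measurable fun a : ℝ × EuclideanSpace ℝ (Fin d) =>
      ENNReal.ofReal (gk d (a.1 * (T n - a.1) / T n) (x + a.1 • y) a.2 * |V a.2|) :=
    measurable_ofReal_gk_mul hV (r := fun s => s * (T n - s) / T n) (p := fun s => x + s • y)
      (by fun_prop) (by fun_prop)
  let G : ℕ → ℝ → ℝ≥0∞ := fun n s =>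
    ∫⁻ z, ENNReal.ofReal (gk d (s * (T n - s) / T n) (x + s • y) z * |V z|)
  have hGm (n : ℕ) : Measurable (G n) := (hm n).lintegral_prod_right'
  have hSv (n : ℕ) : ∫⁻ s in Set.Ioi (0 : ℝ), (Set.Iio (T n)).indicator (G n) s ≤ Ssup d V := by
    rw [lintegral_indicator measurableSet_Iio, Measure.restrict_restrict measurableSet_Iio,
      Set.inter_comm, Set.Ioi_inter_Iio]
    have heq : ∫⁻ s in Set.Ioo 0 (T n), G n s = Sv d V (T n) x (x + T n • y) := by
      refine setLIntegral_congr_fun measurableSet_Ioo fun s hs => lintegral_congr fun z => ?_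
      rw [gk_bridge hs.1 hs.2, add_sub_cancel_left, inv_smul_smul₀ (hT n).ne']
    rw [heq]
    exact le_iSup₂_of_le (T n) (hT n) (le_iSup₂_of_le x (x + T n • y) le_rfl)
  have hle (s : ℝ) (hs : 0 < s) :
      ∫⁻ z, ENNReal.ofReal (gk d s (x + s • y) z * |V z|)
        ≤ Filter.liminf (fun n => (Set.Iio (T n)).indicator (G n) s) Filter.atTop := by
    have hev : (fun n => (Set.Iio (T n)).indicator (G n) s) =ᶠ[Filter.atTop] fun n => G n s := by
      filter_upwards [hTtop.eventually_gt_atTop s] with n hn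
      exact Set.indicator_of_mem (Set.mem_Iio.2 hn) (G n)
    rw [Filter.liminf_congr hev]
    have hr : Filter.Tendsto (fun n => s * (T n - s) / T n) Filter.atTop (nhds s) := by
      have h0 : Filter.Tendsto (fun n => s - s ^ 2 * (T n)⁻¹) Filter.atTop (nhds (s - s ^ 2 * 0)) :=
        tendsto_const_nhds.sub (hTtop.inv_tendsto_atTop.const_mul _)
      rw [mul_zero, sub_zero] at h0
      refine h0.congr fun n => ?_
      have := (hT n).ne'
      field_simp
    exact lintegral_gk_mul_le_liminf hV hs hr _
  calc driftPotential V x y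
      ≤ ∫⁻ s in Set.Ioi (0 : ℝ),
          Filter.liminf (fun n => (Set.Iio (T n)).indicator (G n) s) Filter.atTop :=
        setLIntegral_mono' measurableSet_Ioi hle
    _ ≤ Filter.liminf (fun n => ∫⁻ s in Set.Ioi (0 : ℝ), (Set.Iio (T n)).indicator (G n) s)
          Filter.atTop :=
        lintegral_liminf_le fun n => (hGm n).indicator measurableSet_Iio
    _ ≤ Filter.liminf (fun _ : ℕ => Ssup d V) Filter.atTop :=
        Filter.liminf_le_liminf (Filter.Eventually.of_forall hSv)
    _ = Ssup d V := Filter.liminf_const _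

end

theorem comparability_of_S_and_estar (d : ℕ) :
    ∃ c₁ c₂ : ℝ, 0 < c₁ ∧ 0 < c₂ ∧
      ∀ V : EuclideanSpace ℝ (Fin d) → ℝ, Measurable V →
        ENNReal.ofReal (c₁ * (4 * Real.pi) ^ ((d : ℝ) / 2)) * estar d V ≤ Ssup d V ∧
          Ssup d V ≤ ENNReal.ofReal (c₂ * (4 * Real.pi) ^ ((d : ℝ) / 2)) * estar d V := by
  have hpi := Real.pi_pos
  have hcancel : (4 * π) ^ (-((d : ℝ) / 2)) * (4 * π) ^ ((d : ℝ) / 2) = 1 := by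
    rw [← Real.rpow_add (by positivity), neg_add_cancel, Real.rpow_zero]
  refine ⟨(4 * π) ^ (-((d : ℝ) / 2)), 2 ^ ((d : ℝ) / 2) * 2 * (4 * π) ^ (-((d : ℝ) / 2)),
    by positivity, by positivity, fun V hV => ?_⟩
  rw [mul_assoc _ ((4 * π) ^ (-((d : ℝ) / 2))), hcancel, ENNReal.ofReal_one, one_mul, mul_one,
    estar_eq_iSup_driftPotential hV]
  refine ⟨iSup₂_le fun x y => driftPotential_le_Ssup hV x y,
    iSup₂_le fun t _ => iSup₂_le fun x y => (Sv_le hV t x y).trans ?_⟩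
  have hsup (u v : EuclideanSpace ℝ (Fin d)) : driftPotential V u v ≤
      ⨆ (x : EuclideanSpace ℝ (Fin d)) (y : EuclideanSpace ℝ (Fin d)), driftPotential V x y :=
    le_iSup₂_of_le u v le_rfl
  rw [ENNReal.ofReal_mul (by positivity), mul_assoc, ENNReal.ofReal_ofNat, two_mul]
  gcongr <;> exact hsup _ _
end

section
/- For every d ≥ 3 there exists a Borel measurable function V : ℝ^d → (-∞,0] such that ‖S(V)‖_∞ = sup_{t>0, x,y∈ℝ^d} S(V,t,x,y) < ∞ (so the heat kernel of Δ+V satisfies the sharp global Gaussian bounds), yet V ∉ L¹(ℝ^d) and V ∉ L^p_loc(ℝ^d) for every p > 1. -/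
open MeasureTheory Real
open scoped ENNReal

open ProbabilityTheory in
lemma gk_eq_prod_gaussianPDFReal {d : ℕ} {τ : ℝ} (hτ : 0 < τ) (m z : EuclideanSpace ℝ (Fin d)) :
    gk d τ m z = ∏ i, gaussianPDFReal (m i) (2 * τ).toNNReal (z i) := by
  have h2 : ((2 * τ).toNNReal : ℝ) = 2 * τ := Real.coe_toNNReal _ (by positivity)
  simp only [gaussianPDFReal, h2, Finset.prod_mul_distrib, ← Real.exp_sum, Finset.prod_const,
    Finset.card_univ, Fintype.card_fin, gk, EuclideanSpace.real_norm_sq_eq, PiLp.sub_apply]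
  congr 1
  · rw [show 2 * π * (2 * τ) = 4 * π * τ by ring, Real.sqrt_eq_rpow,
      ← Real.rpow_neg (by positivity), ← Real.rpow_natCast, ← Real.rpow_mul (by positivity)]
    congr 1
    ring
  · rw [← Finset.sum_neg_distrib, Finset.sum_div]
    congr 1
    refine Finset.sum_congr rfl fun i _ => ?_
    congr 1
    ring

lemma gk_mul_gk_div_gk {d : ℕ} {s t : ℝ} (hs : 0 < s) (hst : s < t)
    (x y z : EuclideanSpace ℝ (Fin d)) :
    gk d s x z * gk d (t - s) z y / gk d t x y
      = gk d (s * (t - s) / t) (x + (s / t) • (y - x)) z := by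
  have ht : 0 < t := hs.trans hst
  have hts : 0 < t - s := sub_pos.2 hst
  have hpi := Real.pi_pos
  unfold gk
  rw [mul_mul_mul_comm, mul_div_mul_comm, ← Real.mul_rpow (by positivity) (by positivity),
    ← Real.div_rpow (by positivity) (by positivity), ← Real.exp_add, ← Real.exp_sub]
  congr 2
  · field_simp
  · have h1 : y - z = (y - x) - (z - x) := by abel
    have h2 : z - (x + (s / t) • (y - x)) = (z - x) - (s / t) • (y - x) := by abel
    rw [h1, h2]
    generalize y - x = v
    generalize z - x = u
    rw [norm_sub_sq_real, norm_sub_sq_real, real_inner_smul_right, norm_smul,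
      real_inner_comm, mul_pow, Real.norm_eq_abs, sq_abs]
    field_simp
    ring

open ProbabilityTheory in
lemma setIntegral_gaussianPDFReal_le {m l L s τ : ℝ} (hL : 0 ≤ L) (hs : 0 < s) (hτ : s / 2 ≤ τ) :
    ∫ w in Set.Ico l (l + L), gaussianPDFReal m (2 * τ).toNNReal w ≤ min 1 (L / √s) := by
  have hτ0 : 0 < τ := by linarith
  have h2 : ((2 * τ).toNNReal : ℝ) = 2 * τ := Real.coe_toNNReal _ (by positivity)
  have hv : (2 * τ).toNNReal ≠ 0 := by simpa using hτ0
  refine le_min ?_ ?_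
  · rw [← integral_gaussianPDFReal_eq_one m hv]
    exact setIntegral_le_integral (integrable_gaussianPDFReal _ _)
      (ae_of_all _ (gaussianPDFReal_nonneg _ _))
  · have hb : ∀ w ∈ Set.Ico l (l + L), ‖gaussianPDFReal m (2 * τ).toNNReal w‖ ≤ (√s)⁻¹ := by
      intro w _
      rw [Real.norm_of_nonneg (gaussianPDFReal_nonneg _ _ _), gaussianPDFReal, h2]
      refine (mul_le_of_le_one_right (by positivity) (Real.exp_le_one_iff.2 ?_)).trans ?_
      · rw [neg_div]
        exact neg_nonpos.2 (by positivity)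
      · gcongr
        nlinarith [Real.pi_gt_three]
    refine (le_abs_self _).trans ((norm_setIntegral_le_of_norm_le_const (by simp) hb).trans ?_)
    rw [Measure.real, Real.volume_Ico, ENNReal.toReal_ofReal (by linarith)]
    rw [add_sub_cancel_left, div_eq_mul_inv, mul_comm]

/-- The half-open box in `ℝ^d` with lower corner `l` and side lengths `L`. -/
def box {d : ℕ} (l L : Fin d → ℝ) : Set (EuclideanSpace ℝ (Fin d)) :=
  {z | ∀ i, z i ∈ Set.Ico (l i) (l i + L i)}

lemma box_eq_preimage {d : ℕ} (l L : Fin d → ℝ) :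
    box l L = WithLp.ofLp ⁻¹' Set.univ.pi fun i => Set.Ico (l i) (l i + L i) := by
  ext z
  simp [box]

lemma measurableSet_box {d : ℕ} (l L : Fin d → ℝ) : MeasurableSet (box l L) := by
  rw [box_eq_preimage]
  exact (PiLp.volume_preserving_ofLp (Fin d)).measurable
    (MeasurableSet.univ_pi fun _ => measurableSet_Ico)

lemma volume_box {d : ℕ} (l L : Fin d → ℝ) :
    volume (box l L) = ∏ i, ENNReal.ofReal (L i) := by
  rw [box_eq_preimage, (PiLp.volume_preserving_ofLp (Fin d)).measure_preimage
    (MeasurableSet.univ_pi fun _ => measurableSet_Ico).nullMeasurableSet, volume_pi_pi]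
  simp

open ProbabilityTheory in
lemma setLIntegral_box_gk_le {d : ℕ} {l L : Fin d → ℝ} (hL : ∀ i, 0 ≤ L i) {s τ : ℝ}
    (hs : 0 < s) (hτ : s / 2 ≤ τ) (m : EuclideanSpace ℝ (Fin d)) :
    ∫⁻ z in box l L, ENNReal.ofReal (gk d τ m z)
      ≤ ENNReal.ofReal (∏ i, min 1 (L i / √s)) := by
  have hτ0 : 0 < τ := by linarith
  simp only [gk_eq_prod_gaussianPDFReal hτ0]
  rw [box_eq_preimage, (PiLp.volume_preserving_ofLp (Fin d)).setLIntegral_comp_preimage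
    (f := fun z => ENNReal.ofReal (∏ i, gaussianPDFReal (m i) (2 * τ).toNNReal (z i)))
    (MeasurableSet.univ_pi fun _ => measurableSet_Ico) (by fun_prop), volume_pi,
    Measure.restrict_pi_pi, ← ofReal_integral_eq_lintegral_ofReal, integral_fintype_prod_eq_prod]
  · refine ENNReal.ofReal_le_ofReal (Finset.prod_le_prod
      (fun i _ => integral_nonneg (gaussianPDFReal_nonneg _ _))
      fun i _ => setIntegral_gaussianPDFReal_le (hL i) hs hτ)
  · exact Integrable.fintype_prod_dep (f := fun i w => gaussianPDFReal (m i) (2 * τ).toNNReal w)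
      fun i => (integrable_gaussianPDFReal _ _).integrableOn
  · exact ae_of_all _ fun z => Finset.prod_nonneg fun i _ => gaussianPDFReal_nonneg _ _ _

lemma lintegral_Ioi_min_sq_mul_min_le {a b : ℝ} (ha : 0 < a) (hab : a ≤ b) :
    ∫⁻ s in Set.Ioi 0, ENNReal.ofReal (min 1 (a / √s) ^ 2 * min 1 (b / √s))
      ≤ ENNReal.ofReal (a ^ 2 * (3 + 2 * Real.log (b / a))) := by
  have hb : 0 < b := ha.trans_le hab
  have hsq : a ^ 2 ≤ b ^ 2 := by gcongr
  have hlog : 0 ≤ Real.log (b / a) := Real.log_nonneg ((one_le_div ha).2 hab)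
  have hpow : ∀ s : ℝ, 0 < s → min 1 (a / √s) ^ 2 ≤ a ^ 2 / s := fun s hs => by
    calc min 1 (a / √s) ^ 2 ≤ (a / √s) ^ 2 := by gcongr; exact min_le_right _ _
      _ = a ^ 2 / s := by rw [div_pow, Real.sq_sqrt hs.le]
  have hsub : Set.Ioi (0 : ℝ) ⊆
      Set.Ioc 0 (a ^ 2) ∪ (Set.Ioc (a ^ 2) (b ^ 2) ∪ Set.Ioi (b ^ 2)) := by
    rw [Set.Ioc_union_Ioi_eq_Ioi hsq, Set.Ioc_union_Ioi_eq_Ioi (by positivity)]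
  have h1 : ∫⁻ s in Set.Ioc 0 (a ^ 2),
      ENNReal.ofReal (min 1 (a / √s) ^ 2 * min 1 (b / √s)) ≤ ENNReal.ofReal (a ^ 2) := by
    calc _ ≤ ∫⁻ _ in Set.Ioc 0 (a ^ 2), (1 : ℝ≥0∞) := by
          refine lintegral_mono fun s => ENNReal.ofReal_le_one.2 (mul_le_one₀
            (pow_le_one₀ (by positivity) (min_le_left _ _)) (by positivity) (min_le_left _ _))
      _ = _ := by simp
  have h2 : ∫⁻ s in Set.Ioc (a ^ 2) (b ^ 2),
      ENNReal.ofReal (min 1 (a / √s) ^ 2 * min 1 (b / √s))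
        ≤ ENNReal.ofReal (a ^ 2 * (2 * Real.log (b / a))) := by
    have hint : IntervalIntegrable (fun s : ℝ => a ^ 2 * s⁻¹) volume (a ^ 2) (b ^ 2) := by
      refine (intervalIntegral.intervalIntegrable_inv (fun s hs => ?_) continuousOn_id).const_mul _
      rw [Set.uIcc_of_le hsq] at hs
      exact ((by positivity : 0 < a ^ 2).trans_le hs.1).ne'
    calc _ ≤ ∫⁻ s in Set.Ioc (a ^ 2) (b ^ 2), ENNReal.ofReal (a ^ 2 * s⁻¹) := by
          refine setLIntegral_mono' measurableSet_Ioc fun s hs => ENNReal.ofReal_le_ofReal ?_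
          have hs0 : 0 < s := (by positivity : 0 < a ^ 2).trans hs.1
          exact (mul_le_of_le_one_right (by positivity) (min_le_left _ _)).trans (hpow s hs0)
      _ = _ := by
          rw [← ofReal_integral_eq_lintegral_ofReal, ← intervalIntegral.integral_of_le hsq,
            intervalIntegral.integral_const_mul, integral_inv_of_pos (by positivity) (by positivity),
            ← div_pow, Real.log_pow]
          · norm_num
          · exact (intervalIntegrable_iff_integrableOn_Ioc_of_le hsq).1 hint
          · refine ae_restrict_of_forall_mem measurableSet_Ioc fun s hs => ?_
            have hs0 : 0 < s := (by positivity : 0 < a ^ 2).trans hs.1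
            positivity
  have h3 : ∫⁻ s in Set.Ioi (b ^ 2),
      ENNReal.ofReal (min 1 (a / √s) ^ 2 * min 1 (b / √s)) ≤ ENNReal.ofReal (a ^ 2 * 2) := by
    have hb2 : 0 < b ^ 2 := by positivity
    calc _ ≤ ∫⁻ s in Set.Ioi (b ^ 2), ENNReal.ofReal (a ^ 2 * b * s ^ (-(3 / 2) : ℝ)) := by
          refine setLIntegral_mono' measurableSet_Ioi fun s hs => ENNReal.ofReal_le_ofReal ?_
          have hs0 : 0 < s := hb2.trans hs
          calc _ ≤ a ^ 2 / s * (b / √s) := by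
                  gcongr
                  · exact hpow s hs0
                  · exact min_le_right _ _
            _ = _ := by
                  rw [Real.sqrt_eq_rpow, div_mul_div_comm, Real.rpow_neg hs0.le, ← div_eq_mul_inv]
                  congr 1
                  nth_rw 1 [← Real.rpow_one s]
                  rw [← Real.rpow_add hs0]
                  norm_num
      _ = _ := by
          rw [← ofReal_integral_eq_lintegral_ofReal, integral_const_mul,
            integral_Ioi_rpow_of_lt (by norm_num) hb2, ← Real.rpow_natCast b, ← Real.rpow_mul hb.le]
          · norm_num [Real.rpow_neg_one]
            congr 1
            field_simp
          · exact (integrableOn_Ioi_rpow_of_lt (by norm_num) hb2).const_mul _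
          · refine ae_restrict_of_forall_mem measurableSet_Ioi fun s hs => ?_
            have hs0 : 0 < s := hb2.trans hs
            positivity
  calc _ ≤ _ := lintegral_mono_set hsub
    _ ≤ _ := (lintegral_union_le _ _ _).trans (add_le_add le_rfl (lintegral_union_le _ _ _))
    _ ≤ _ := add_le_add h1 (add_le_add h2 h3)
    _ = _ := by
      rw [← ENNReal.ofReal_add (by positivity) (by positivity),
        ← ENNReal.ofReal_add (by positivity) (by positivity)]
      congr 1
      ring

/-- Side lengths equal to `a` in the first two coordinates and to `b` in the others. -/
def sides (d : ℕ) (a b : ℝ) (i : Fin d) : ℝ := if (i : ℕ) < 2 then a else b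

lemma prod_min_sides_le {d : ℕ} (hd : 3 ≤ d) {a b : ℝ} (hb : 0 ≤ b) (s : ℝ) :
    ∏ i, min 1 (sides d a b i / √s) ≤ min 1 (a / √s) ^ 2 * min 1 (b / √s) := by
  obtain ⟨k, rfl⟩ := Nat.exists_eq_add_of_le' hd
  simp only [Fin.prod_univ_succ, sides, Fin.val_zero, Fin.val_succ]
  norm_num
  rw [← mul_assoc, ← mul_assoc, ← sq]
  refine mul_le_of_le_one_right (by positivity) (pow_le_one₀ (by positivity) (min_le_left _ _))

lemma prod_ofReal_sides {d : ℕ} (hd : 3 ≤ d) {a b : ℝ} (ha : 0 ≤ a) :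
    ∏ i, ENNReal.ofReal (sides d a b i) = ENNReal.ofReal (a ^ 2) * ENNReal.ofReal b ^ (d - 2) := by
  obtain ⟨k, rfl⟩ := Nat.exists_eq_add_of_le' hd
  simp only [Fin.prod_univ_succ, sides, Fin.val_zero, Fin.val_succ]
  norm_num
  rw [ENNReal.ofReal_pow ha, show k + 3 - 2 = k + 1 by omega]
  ring

lemma lintegral_gaussian_bridge_box_le {d : ℕ} (hd : 3 ≤ d) {a b : ℝ} (ha : 0 < a) (hab : a ≤ b)
    (l : Fin d → ℝ) {t : ℝ} (x y : EuclideanSpace ℝ (Fin d)) :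
    ∫⁻ s in Set.Ioo 0 t, ∫⁻ z in box l (sides d a b),
        ENNReal.ofReal (gk d s x z * gk d (t - s) z y / gk d t x y)
      ≤ 2 * ENNReal.ofReal (a ^ 2 * (3 + 2 * Real.log (b / a))) := by
  have hb : 0 < b := ha.trans_le hab
  have hL : ∀ i, 0 ≤ sides d a b i := fun i => by
    unfold sides
    split_ifs <;> positivity
  set Φ : ℝ → ℝ≥0∞ := fun s => ENNReal.ofReal (min 1 (a / √s) ^ 2 * min 1 (b / √s)) with hΦ
  have hΦm : Measurable Φ := by fun_prop
  have key : ∀ (s τ : ℝ) (m : EuclideanSpace ℝ (Fin d)), 0 < s → s / 2 ≤ τ →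
      ∫⁻ z in box l (sides d a b), ENNReal.ofReal (gk d τ m z) ≤ Φ s := fun s τ m hs hτ =>
    (setLIntegral_box_gk_le hL hs hτ m).trans
      (ENNReal.ofReal_le_ofReal (prod_min_sides_le hd hb.le s))
  have hrefl : ∫⁻ s in Set.Ioo 0 t, Φ (t - s) = ∫⁻ s in Set.Ioo 0 t, Φ s := by
    have := (Measure.measurePreserving_sub_left volume t).setLIntegral_comp_preimage
      (measurableSet_Ioo (a := 0) (b := t)) hΦm
    simpa using this
  have hIoi : ∫⁻ s in Set.Ioo 0 t, Φ s ≤ ENNReal.ofReal (a ^ 2 * (3 + 2 * Real.log (b / a))) :=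
    (lintegral_mono_set Set.Ioo_subset_Ioi_self).trans (lintegral_Ioi_min_sq_mul_min_le ha hab)
  calc _ ≤ ∫⁻ s in Set.Ioo 0 t, (Φ s + Φ (t - s)) := by
        refine setLIntegral_mono' measurableSet_Ioo fun s hs => ?_
        have ht : 0 < t := hs.1.trans hs.2
        simp only [gk_mul_gk_div_gk hs.1 hs.2 x y]
        rcases le_total s (t / 2) with h | h
        · refine (key s _ _ hs.1 ?_).trans le_self_add
          rw [le_div_iff₀ ht]
          nlinarith [hs.1]
        · refine (key (t - s) _ _ (sub_pos.2 hs.2) ?_).trans le_add_self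
          rw [le_div_iff₀ ht]
          nlinarith [hs.2]
    _ = (∫⁻ s in Set.Ioo 0 t, Φ s) + ∫⁻ s in Set.Ioo 0 t, Φ (t - s) := lintegral_add_left hΦm _
    _ ≤ _ := by
        rw [hrefl, two_mul]
        exact add_le_add hIoi hIoi

lemma tsum_indicator_of_mem {α : Type*} {A : ℕ → Set α}
    (hA : Pairwise fun m n => Disjoint (A m) (A n)) (c : ℕ → ℝ≥0∞) {n : ℕ} {z : α} (hz : z ∈ A n) :
    ∑' k, (A k).indicator (fun _ => c k) z = c n := by
  rw [tsum_eq_single n fun k hk => Set.indicator_of_notMem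
    (fun hzk => Set.disjoint_left.1 (hA hk) hzk hz) _, Set.indicator_of_mem hz]

lemma tsum_indicator_ne_top {α : Type*} {A : ℕ → Set α}
    (hA : Pairwise fun m n => Disjoint (A m) (A n)) {c : ℕ → ℝ≥0∞} (hc : ∀ n, c n ≠ ⊤) (z : α) :
    ∑' k, (A k).indicator (fun _ => c k) z ≠ ⊤ := by
  by_cases h : ∃ n, z ∈ A n
  · obtain ⟨n, hn⟩ := h
    rw [tsum_indicator_of_mem hA c hn]
    exact hc n
  · push Not at h
    simp [Set.indicator_of_notMem (h _)]

lemma lintegral_lintegral_mul_tsum_indicator {α β : Type*} [MeasurableSpace α] [MeasurableSpace β]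
    {μ : Measure α} {ν : Measure β} [SFinite ν] {k : α → β → ℝ≥0∞}
    (hk : Measurable (Function.uncurry k)) {A : ℕ → Set β} (hA : ∀ n, MeasurableSet (A n))
    (c : ℕ → ℝ≥0∞) :
    ∫⁻ s, ∫⁻ z, k s z * ∑' n, (A n).indicator (fun _ => c n) z ∂ν ∂μ
      = ∑' n, c n * ∫⁻ s, ∫⁻ z in A n, k s z ∂ν ∂μ := by
  have hm : ∀ n, Measurable fun s => ∫⁻ z in A n, k s z ∂ν := fun n => hk.lintegral_prod_right'
  simp only [← lintegral_const_mul _ (hm _)]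
  rw [← lintegral_tsum fun n => ((hm n).const_mul _).aemeasurable]
  refine lintegral_congr fun s => ?_
  have hks : Measurable (k s) := hk.of_uncurry_left
  calc _ = ∫⁻ z, ∑' n, (A n).indicator (fun z => c n * k s z) z ∂ν := by
        refine lintegral_congr fun z => ?_
        rw [← ENNReal.tsum_mul_left]
        refine tsum_congr fun n => ?_
        by_cases hz : z ∈ A n <;> simp [hz, mul_comm]
    _ = _ := by
        rw [lintegral_tsum fun n => ((hks.const_mul _).indicator (hA n)).aemeasurable]
        refine tsum_congr fun n => ?_
        rw [lintegral_indicator (hA n), lintegral_const_mul _ hks]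

lemma measurable_gk_s19 {d : ℕ} : Measurable
    fun p : ℝ × EuclideanSpace ℝ (Fin d) × EuclideanSpace ℝ (Fin d) => gk d p.1 p.2.1 p.2.2 := by
  unfold gk
  fun_prop

lemma measurable_gk_mul_gk_div {d : ℕ} (t r : ℝ) (x y : EuclideanSpace ℝ (Fin d)) :
    Measurable (Function.uncurry fun s z =>
      ENNReal.ofReal (gk d s x z * gk d (t - s) z y / r)) := by
  have h1 : Measurable fun p : ℝ × EuclideanSpace ℝ (Fin d) => gk d p.1 x p.2 :=
    measurable_gk_s19.comp (measurable_fst.prodMk (measurable_const.prodMk measurable_snd))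
  have h2 : Measurable fun p : ℝ × EuclideanSpace ℝ (Fin d) => gk d (t - p.1) p.2 y :=
    measurable_gk_s19.comp ((measurable_const.sub measurable_fst).prodMk
      (measurable_snd.prodMk measurable_const))
  exact ((h1.mul h2).div_const r).ennreal_ofReal

lemma Sv_eq_tsum {d : ℕ} {V : EuclideanSpace ℝ (Fin d) → ℝ}
    {A : ℕ → Set (EuclideanSpace ℝ (Fin d))} (hA : ∀ n, MeasurableSet (A n)) {c : ℕ → ℝ≥0∞}
    (hV : ∀ z, ENNReal.ofReal |V z| = ∑' n, (A n).indicator (fun _ => c n) z)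
    (t : ℝ) (x y : EuclideanSpace ℝ (Fin d)) :
    Sv d V t x y = ∑' n, c n * ∫⁻ s in Set.Ioo 0 t, ∫⁻ z in A n,
      ENNReal.ofReal (gk d s x z * gk d (t - s) z y / gk d t x y) := by
  simp only [Sv, ENNReal.ofReal_mul' (abs_nonneg _), hV]
  exact lintegral_lintegral_mul_tsum_indicator (measurable_gk_mul_gk_div t _ x y) hA c

/-- A thin box accumulating at the origin, of size `exp (-2 ^ n)` in two directions and `4 ^ n`
in the others. -/
def thinBox (d n : ℕ) : Set (EuclideanSpace ℝ (Fin d)) :=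
  box (fun i => if (i : ℕ) = 0 then Real.exp (-2 ^ n) else 0)
    (sides d (Real.exp (-2 ^ n)) ((2 ^ n) ^ 2))

/-- The value of the potential on `thinBox d n`. -/
noncomputable def height (n : ℕ) : ℝ := Real.exp (2 * 2 ^ n) / (2 ^ n) ^ 2

lemma height_pos (n : ℕ) : 0 < height n := by
  unfold height
  positivity

lemma measurableSet_thinBox (d n : ℕ) : MeasurableSet (thinBox d n) := measurableSet_box _ _

lemma pairwise_disjoint_thinBox {d : ℕ} (hd : 3 ≤ d) :
    Pairwise fun m n => Disjoint (thinBox d m) (thinBox d n) := by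
  refine (pairwise_disjoint_on _).2 fun m n hmn =>
    Set.disjoint_left.2 fun z hm hn => ?_
  have h1 := (hm ⟨0, by omega⟩).1
  have h2 := (hn ⟨0, by omega⟩).2
  simp only [sides, if_true, Nat.ofNat_pos] at h1 h2
  have hpow : (2 : ℝ) ^ m + 1 ≤ 2 ^ n := by
    have h3 : (2 : ℝ) ^ (m + 1) ≤ 2 ^ n := pow_le_pow_right₀ (by norm_num) hmn
    have h4 : (1 : ℝ) ≤ 2 ^ m := one_le_pow₀ (by norm_num)
    rw [pow_succ] at h3
    linarith
  have h5 : Real.exp (-2 ^ n) ≤ Real.exp (-2 ^ m) * Real.exp (-1) := by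
    rw [← Real.exp_add]
    exact Real.exp_le_exp.2 (by linarith)
  nlinarith [Real.exp_pos (-2 ^ m), Real.exp_neg_one_lt_half]

lemma exp_neg_le_one (n : ℕ) : Real.exp (-2 ^ n) ≤ 1 :=
  Real.exp_le_one_iff.2 (neg_nonpos.2 (by positivity))

lemma one_le_height_mul_volume_thinBox {d : ℕ} (hd : 3 ≤ d) (n : ℕ) :
    1 ≤ ENNReal.ofReal (height n) * volume (thinBox d n) := by
  have hN : (1 : ℝ) ≤ 2 ^ n := one_le_pow₀ (by norm_num)
  rw [thinBox, volume_box, prod_ofReal_sides hd (Real.exp_pos _).le, ← mul_assoc,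
    ← ENNReal.ofReal_pow (by positivity), ← ENNReal.ofReal_mul (height_pos n).le,
    ← ENNReal.ofReal_mul (by unfold height; positivity), ENNReal.one_le_ofReal]
  calc (1 : ℝ) = height n * Real.exp (-2 ^ n) ^ 2 * (2 ^ n) ^ 2 := by
        rw [height, ← Real.exp_nat_mul, div_mul_eq_mul_div, ← Real.exp_add]
        field_simp
        norm_num
    _ ≤ _ := by
        gcongr
        · exact mul_nonneg (height_pos n).le (by positivity)
        · exact le_self_pow₀ (one_le_pow₀ hN) (by omega)

lemma height_mul_profile_le (n : ℕ) :
    height n * (Real.exp (-2 ^ n) ^ 2 *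
      (3 + 2 * Real.log ((2 ^ n) ^ 2 / Real.exp (-2 ^ n)))) ≤ 9 * (1 / 2) ^ n := by
  have hN : (1 : ℝ) ≤ 2 ^ n := one_le_pow₀ (by norm_num)
  have hlog : Real.log (2 ^ n) ≤ 2 ^ n - 1 := Real.log_le_sub_one_of_pos (by positivity)
  have hc : height n * Real.exp (-2 ^ n) ^ 2 = ((2 ^ n) ^ 2)⁻¹ := by
    rw [height, ← Real.exp_nat_mul, div_mul_eq_mul_div, ← Real.exp_add]
    norm_num
  rw [← mul_assoc, hc, Real.log_div (by positivity) (by positivity), Real.log_exp, Real.log_pow,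
    one_div, inv_pow, inv_mul_le_iff₀ (by positivity)]
  field_simp
  push_cast
  linarith

lemma exists_subset_thinBox {d : ℕ} (hd : 3 ≤ d) (n : ℕ) : ∃ B ⊆ thinBox d n, MeasurableSet B ∧
    B ⊆ box (fun _ => 0) (fun _ => 2) ∧
    volume B = ENNReal.ofReal (Real.exp (-2 ^ n) ^ 2) := by
  have hN : (1 : ℝ) ≤ (2 ^ n) ^ 2 := one_le_pow₀ (one_le_pow₀ (by norm_num))
  have ha := exp_neg_le_one n
  have ha0 := Real.exp_pos (-2 ^ n)
  refine ⟨box (fun i => if (i : ℕ) = 0 then Real.exp (-2 ^ n) else 0)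
    (sides d (Real.exp (-2 ^ n)) 1), fun z hz i => ?_, measurableSet_box _ _, fun z hz i => ?_, ?_⟩
  · refine ⟨(hz i).1, (hz i).2.trans_le ?_⟩
    unfold sides
    split_ifs <;> linarith
  · obtain ⟨h1, h2⟩ := hz i
    simp only [sides] at h1 h2
    simp only [Set.mem_Ico]
    constructor
    · split_ifs at h1 h2 <;> linarith
    · split_ifs at h1 h2 <;> linarith
  · rw [volume_box, prod_ofReal_sides hd ha0.le]
    simp

lemma tendsto_height_rpow_mul {p : ℝ} (hp : 1 < p) :
    Filter.Tendsto (fun n => height n ^ p * Real.exp (-2 ^ n) ^ 2) Filter.atTop Filter.atTop := by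
  have h := (tendsto_exp_mul_div_rpow_atTop (2 * p) (2 * (p - 1)) (by linarith)).comp
    (tendsto_pow_atTop_atTop_of_one_lt (r := (2 : ℝ)) (by norm_num))
  refine h.congr fun n => ?_
  rw [Function.comp_apply, height, Real.div_rpow (by positivity) (by positivity), ← Real.exp_mul,
    ← Real.exp_nat_mul, div_mul_eq_mul_div, ← Real.exp_add, ← Real.rpow_natCast _ 2,
    ← Real.rpow_mul (by positivity)]
  congr 2
  push_cast
  ring

lemma isBounded_box {d : ℕ} (l L : Fin d → ℝ) : Bornology.IsBounded (box l L) := by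
  rw [box_eq_preimage]
  refine (PiLp.antilipschitzWith_ofLp 2 (fun _ : Fin d => ℝ)).isBounded_preimage ?_
  exact Bornology.IsBounded.pi fun i => Metric.isBounded_Ico _ _

/-- A potential concentrated on the boxes `thinBox d n`. -/
noncomputable def thinPotential (d : ℕ) (z : EuclideanSpace ℝ (Fin d)) : ℝ :=
  -(∑' n, (thinBox d n).indicator (fun _ => ENNReal.ofReal (height n)) z).toReal

lemma ofReal_abs_thinPotential {d : ℕ} (hd : 3 ≤ d) (z : EuclideanSpace ℝ (Fin d)) :
    ENNReal.ofReal |thinPotential d z|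
      = ∑' n, (thinBox d n).indicator (fun _ => ENNReal.ofReal (height n)) z := by
  rw [thinPotential, abs_neg, abs_of_nonneg ENNReal.toReal_nonneg, ENNReal.ofReal_toReal
    (tsum_indicator_ne_top (pairwise_disjoint_thinBox hd) (fun _ => ENNReal.ofReal_ne_top) z)]

lemma abs_thinPotential_of_mem {d : ℕ} (hd : 3 ≤ d) {n : ℕ} {z : EuclideanSpace ℝ (Fin d)}
    (hz : z ∈ thinBox d n) : |thinPotential d z| = height n := by
  rw [thinPotential, tsum_indicator_of_mem (pairwise_disjoint_thinBox hd) _ hz, abs_neg,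
    ENNReal.toReal_ofReal (height_pos n).le, abs_of_pos (height_pos n)]

lemma measurable_thinPotential (d : ℕ) : Measurable (thinPotential d) :=
  (Measurable.tsum fun n =>
    measurable_const.indicator (measurableSet_thinBox d n)).ennreal_toReal.neg

lemma Ssup_thinPotential_lt_top {d : ℕ} (hd : 3 ≤ d) : Ssup d (thinPotential d) < ⊤ := by
  have hsum : Summable fun n : ℕ => 2 * (9 * (1 / 2 : ℝ) ^ n) :=
    (summable_geometric_two.mul_left 9).mul_left 2
  refine lt_of_le_of_lt ?_ (ENNReal.ofReal_lt_top (r := ∑' n : ℕ, 2 * (9 * (1 / 2 : ℝ) ^ n)))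
  refine iSup₂_le fun t _ => iSup₂_le fun x y => ?_
  rw [Sv_eq_tsum (measurableSet_thinBox d) (ofReal_abs_thinPotential hd),
    ENNReal.ofReal_tsum_of_nonneg (fun n => by positivity) hsum]
  refine ENNReal.tsum_le_tsum fun n => ?_
  have hN : (1 : ℝ) ≤ (2 ^ n) ^ 2 := one_le_pow₀ (one_le_pow₀ (by norm_num))
  refine (mul_le_mul_right (lintegral_gaussian_bridge_box_le hd (Real.exp_pos _)
    ((exp_neg_le_one n).trans hN) _ x y) _).trans ?_
  rw [mul_left_comm, ← ENNReal.ofReal_mul (height_pos n).le, ENNReal.ofReal_mul zero_le_two,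
    ENNReal.ofReal_ofNat]
  exact mul_le_mul_right (ENNReal.ofReal_le_ofReal (height_mul_profile_le n)) _

lemma not_integrable_thinPotential {d : ℕ} (hd : 3 ≤ d) : ¬ Integrable (thinPotential d) := by
  intro h
  refine h.2.ne (top_unique ?_)
  simp only [← ofReal_norm, Real.norm_eq_abs, ofReal_abs_thinPotential hd]
  rw [lintegral_tsum fun n =>
    (measurable_const.indicator (measurableSet_thinBox d n)).aemeasurable]
  simp only [lintegral_indicator_const (measurableSet_thinBox d _)]
  calc (⊤ : ℝ≥0∞) = ∑' _ : ℕ, 1 := by simp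
    _ ≤ _ := ENNReal.tsum_le_tsum (one_le_height_mul_volume_thinBox hd)

lemma lintegral_thinPotential_rpow_eq_top {d : ℕ} (hd : 3 ≤ d) {p : ℝ} (hp : 1 < p) :
    ∫⁻ z in box (fun _ => 0) (fun _ => 2), ENNReal.ofReal (|thinPotential d z| ^ p) = ⊤ := by
  refine top_unique (le_of_tendsto'
    (ENNReal.tendsto_ofReal_atTop.comp (tendsto_height_rpow_mul hp)) fun n => ?_)
  obtain ⟨B, hB, hBm, hBs, hvol⟩ := exists_subset_thinBox hd n
  calc _ = ∫⁻ _ in B, ENNReal.ofReal (height n ^ p) := by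
        rw [setLIntegral_const, hvol, Function.comp_apply,
          ENNReal.ofReal_mul (Real.rpow_nonneg (height_pos n).le _)]
    _ = ∫⁻ z in B, ENNReal.ofReal (|thinPotential d z| ^ p) :=
        setLIntegral_congr_fun hBm fun z hz => by
          simp only [abs_thinPotential_of_mem hd (hB hz)]
    _ ≤ _ := lintegral_mono_set hBs

theorem exists_sharp_gaussian_without_Lp
    (d : ℕ) (hd : 3 ≤ d) :
    ∃ V : EuclideanSpace ℝ (Fin d) → ℝ, Measurable V ∧ (∀ z, V z ≤ 0) ∧
      Ssup d V < ⊤ ∧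
      ¬ Integrable V volume ∧
      ∀ p : ℝ, 1 < p →
        ¬ ∀ B : Set (EuclideanSpace ℝ (Fin d)),
            Bornology.IsBounded B → MeasurableSet B →
            (∫⁻ z in B, ENNReal.ofReal (|V z| ^ p)) < ⊤ := by
  exact ⟨thinPotential d, measurable_thinPotential d, fun z => neg_nonpos.2 ENNReal.toReal_nonneg,
    Ssup_thinPotential_lt_top hd, not_integrable_thinPotential hd, fun p hp h =>
      (h _ (isBounded_box _ _) (measurableSet_box _ _)).ne
        (lintegral_thinPotential_rpow_eq_top hd hp)⟩
end
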